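/- Consider N ≥ 2 cars on a single road with the first-order follow-the-leader dynamics: let x : [0,T] → ℝᴺ be differentiable with ẋᵢ(t) = v(xᵢ₊₁(t) − xᵢ(t)) for i = 1, …, N−1 and ẋ_N(t) = v_max. If the initial spacings satisfy xᵢ₊₁(0) − xᵢ(0) ≥ ℓ for every i = 1, …, N−1, then the spacings remain at least ℓ for all times: xᵢ₊₁(t) − xᵢ(t) ≥ ℓ for every i = 1, …, N−1 and every t ∈ [0,T]. -/

import Mathlib

/-- The follow-the-leader velocity function: `vel vmax ℓ δ = 0` for `δ < ℓ` and
`vel vmax ℓ δ = vmax * (1 - ℓ/δ)` for `δ ≥ ℓ`. -/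
noncomputable def vel (vmax ℓ : ℝ) (δ : ℝ) : ℝ :=
  if δ < ℓ then 0 else vmax * (1 - ℓ / δ)

theorem vel_nonneg {vmax ℓ : ℝ} (hv : 0 ≤ vmax) (hl : 0 < ℓ) (δ : ℝ) : 0 ≤ vel vmax ℓ δ := by
  unfold vel
  split_ifs with h
  · exact le_rfl
  · rw [not_lt] at h
    exact mul_nonneg hv (sub_nonneg.2 ((div_le_one (hl.trans_le h)).2 h))

/-- A function that starts at or above a level `c`, and whose derivative is nonnegative whenever
it is below `c`, stays at or above `c`. -/
theorem le_of_hasDerivWithinAt_nonneg_of_lt {f f' : ℝ → ℝ} {a b c : ℝ}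
    (hf : ∀ t ∈ Set.Icc a b, HasDerivWithinAt f (f' t) (Set.Icc a b) t)
    (hf' : ∀ t ∈ Set.Icc a b, f t < c → 0 ≤ f' t) (ha : c ≤ f a) :
    ∀ t ∈ Set.Icc a b, c ≤ f t := by
  have barrier : ∀ ε > 0, ∀ t ∈ Set.Icc a b, -f t ≤ -c + ε * (1 + (t - a)) := by
    intro ε hε t ht
    refine image_le_of_deriv_right_lt_deriv_boundary (f := fun s => -f s) (f' := fun s => -f' s)
      (B := fun s => -c + ε * (1 + (s - a))) (B' := fun _ => ε)
      (fun s hs => (hf s hs).continuousWithinAt.neg) (fun s hs => ?_) ?_ (fun s => ?_)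
      (fun s hs h => ?_) ht
    · exact ((hf s (Set.Ico_subset_Icc_self hs)).mono_of_mem_nhdsWithin
        (Icc_mem_nhdsGE_of_mem hs)).neg
    · simp only [sub_self]
      linarith
    · simpa using ((((hasDerivAt_id s).sub_const a).const_add 1).const_mul ε).const_add (-c)
    · have hpos : 0 < ε * (1 + (s - a)) := mul_pos hε (by linarith [hs.1])
      have := hf' s (Set.Ico_subset_Icc_self hs) (by linarith)
      linarith
  intro t ht
  have hta : 0 < 1 + (t - a) := by linarith [ht.1]
  refine le_of_forall_pos_le_add fun η hη => ?_
  have := barrier (η / (1 + (t - a))) (div_pos hη hta) t ht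
  rw [div_mul_cancel₀ _ hta.ne'] at this
  linarith

/-- For `N ≥ 2` cars on a single road with first-order
follow-the-leader dynamics on `[0,T]` (`ẋᵢ = v(xᵢ₊₁ − xᵢ)` for `i = 1,…,N−1`,
`ẋ_N = v_max`), if the initial spacings satisfy `xᵢ₊₁(0) − xᵢ(0) ≥ ℓ` for every
`i = 1,…,N−1`, then the spacings remain at least `ℓ` for all times:
`xᵢ₊₁(t) − xᵢ(t) ≥ ℓ` for every such `i` and every `t ∈ [0,T]`. -/
theorem ftl_spacing_invariant (vmax ℓ : ℝ) (hv : 0 < vmax) (hl : 0 < ℓ)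
    (N : ℕ) (hN : 2 ≤ N) (T : ℝ) (hT : 0 ≤ T) (x : ℝ → Fin N → ℝ)
    (hderiv : ∀ i : Fin N, ∀ t ∈ Set.Icc (0 : ℝ) T,
      HasDerivWithinAt (fun s => x s i)
        (if h : (i : ℕ) + 1 < N then vel vmax ℓ (x t ⟨(i : ℕ) + 1, h⟩ - x t i)
         else vmax)
        (Set.Icc (0 : ℝ) T) t)
    (hinit : ∀ (i : Fin N) (h : (i : ℕ) + 1 < N), x 0 ⟨(i : ℕ) + 1, h⟩ - x 0 i ≥ ℓ) :
    ∀ (i : Fin N) (h : (i : ℕ) + 1 < N), ∀ t ∈ Set.Icc (0 : ℝ) T,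
      x t ⟨(i : ℕ) + 1, h⟩ - x t i ≥ ℓ := by
  intro i h
  refine le_of_hasDerivWithinAt_nonneg_of_lt
    (fun t ht => (hderiv ⟨(i : ℕ) + 1, h⟩ t ht).sub (hderiv i t ht)) (fun t _ hlt => ?_) (hinit i h)
  have hzero : vel vmax ℓ (x t ⟨(i : ℕ) + 1, h⟩ - x t i) = 0 := if_pos hlt
  rw [dif_pos h, hzero, sub_zero]
  split_ifs
  · exact vel_nonneg hv.le hl _
  · exact hv.le
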